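/- arXiv:2508.18176 — 2 statements merged into one kernel-verified Lean document; each statement's English description precedes it below -/
import Mathlib

section
/- Let (Δ,δ) be a building of type (W,S) where W satisfies the nested condition relative to u ∈ S. Let C, D, E ∈ Δ and let φ, φ₁, φ₂ : W → Δ be isometries with φ(1) = D = φ₁(1), φ(w) = C, φ₁(w₁) = E, φ₂(1) = C, and φ₂(w₂) = E, for elements w, w₁, w₂ ∈ W. If w·H_u^† ⊊ H_u^+ for some sign † ∈ {+, −} and H_u^+ = w₁·H_u^-, then H_u^† ⊊ w₂·H_u^-. -/
open Pointwise
open scoped Classical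

variable {B : Type*} {W : Type*} [Group W] {M : CoxeterMatrix B}

/-- The positive root `H_s^+` associated to the generator indexed by `i`:
elements `g` with `l(sg) > l(g)`. -/
def Hp (cs : CoxeterSystem M W) (i : B) : Set W :=
  {g : W | cs.length g < cs.length (cs.simple i * g)}

/-- The negative root `H_s^-`: elements `g` with `l(sg) < l(g)`. -/
def Hm (cs : CoxeterSystem M W) (i : B) : Set W :=
  {g : W | cs.length (cs.simple i * g) < cs.length g}

/-- `g` satisfies one of the six cases of the nested condition relative to `s`. -/
def NestedAt (cs : CoxeterSystem M W) (i : B) (g : W) : Prop :=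
  g • Hp cs i = Hp cs i ∨ g • Hp cs i = Hm cs i ∨
  g • Hp cs i ⊂ Hp cs i ∨ g • Hp cs i ⊂ Hm cs i ∨
  g • Hm cs i ⊂ Hp cs i ∨ g • Hm cs i ⊂ Hm cs i

/-- `W` satisfies the nested condition relative to the generator indexed by `i`. -/
def Nested (cs : CoxeterSystem M W) (i : B) : Prop := ∀ g : W, NestedAt cs i g

/-- The stabilizer `Stab_{H_s^+}` of the positive root. -/
def StabHp (cs : CoxeterSystem M W) (i : B) : Set W :=
  {g : W | g • Hp cs i = Hp cs i}

/-- The multiplier `m_W^s`. -/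
noncomputable def mWs (cs : CoxeterSystem M W) (i : B) (g : W) : ℤ :=
  if g ∈ Hp cs i then 1 else -1

/-- `(Δ, d)` is a building of type `(W,S)`: axioms (B1), (B2), (B3). -/
def IsBuilding (cs : CoxeterSystem M W) (Δ : Type*) (d : Δ → Δ → W) : Prop :=
  Nonempty Δ ∧
  (∀ C D : Δ, d C D = 1 ↔ C = D) ∧
  (∀ (C D E : Δ) (i : B), d E C = cs.simple i →
    (d E D = cs.simple i * d C D ∨ d E D = d C D) ∧
    (cs.length (d C D) < cs.length (cs.simple i * d C D) → d E D = cs.simple i * d C D)) ∧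
  (∀ (C D : Δ) (i : B), ∃ E : Δ, d E C = cs.simple i ∧ d E D = cs.simple i * d C D)

/-- `φ : W → Δ` is an isometry into the building. -/
def IsIsom {Δ : Type*} (d : Δ → Δ → W) (φ : W → Δ) : Prop :=
  ∀ a b : W, d (φ a) (φ b) = a⁻¹ * b

/-- The action of a simple reflection on `W × ZMod 2` used to count inversions modulo two. -/
noncomputable def signedConj (cs : CoxeterSystem M W) (i : B) : Function.End (W × ZMod 2) := fun p =>
  (cs.simple i * p.1 * cs.simple i, p.2 + if p.1 = cs.simple i then 1 else 0)

theorem prod_signedConj_reverse (cs : CoxeterSystem M W) (ω : List B) (t : W) (e : ZMod 2) :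
    (ω.reverse.map (signedConj cs)).prod (t, e) =
      ((cs.wordProd ω)⁻¹ * t * cs.wordProd ω, e + ((cs.leftInvSeq ω).count t : ZMod 2)) := by
  induction ω generalizing t e with
  | nil => simp; rfl
  | cons i ω ih =>
    have hstep : ((i :: ω).reverse.map (signedConj cs)).prod (t, e) =
        (ω.reverse.map (signedConj cs)).prod (signedConj cs i (t, e)) := by
      simp only [List.reverse_cons, List.map_append, List.prod_append, List.map_cons, List.map_nil,
        List.prod_singleton]
      rfl
    have hcount : (List.map (MulAut.conj (cs.simple i)) (cs.leftInvSeq ω)).count t =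
        (cs.leftInvSeq ω).count (cs.simple i * t * cs.simple i) := by
      have ht : t = MulAut.conj (cs.simple i) (cs.simple i * t * cs.simple i) := by
        simp [mul_assoc]
      conv_lhs => rw [ht]
      exact List.count_map_of_injective _ _ (MulAut.conj (cs.simple i)).injective _
    rw [hstep, signedConj, ih]
    ext
    · simp [cs.wordProd_cons, mul_assoc]
    · simp only [CoxeterSystem.leftInvSeq, List.count_cons, hcount, beq_iff_eq, eq_comm (a := t)]
      split_ifs <;> push_cast <;> ring

theorem even_count_leftInvSeq_alternatingWord (cs : CoxeterSystem M W) (i j : B) (t : W) :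
    Even ((cs.leftInvSeq (CoxeterSystem.alternatingWord i j (2 * M i j))).count t) := by
  have hlist : cs.leftInvSeq (CoxeterSystem.alternatingWord i j (2 * M i j)) =
      (List.range (M i j)).map (fun k => cs.wordProd (CoxeterSystem.alternatingWord j i (2 * k + 1)))
      ++ (List.range (M i j)).map
        (fun k => cs.wordProd (CoxeterSystem.alternatingWord j i (2 * k + 1))) := by
    apply List.ext_getElem
    · simp; ring
    · intro k h₁ h₂
      have hk : k < 2 * M i j := by simpa using h₁
      rw [cs.getElem_leftInvSeq_alternatingWord i j (M i j) k hk]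
      rw [List.getElem_append]
      split_ifs with h
      · simp
      · simp only [List.length_map, List.length_range, not_lt] at h
        obtain ⟨l, rfl⟩ := Nat.exists_eq_add_of_le h
        simp only [List.length_map, List.length_range, List.getElem_map, List.getElem_range,
          Nat.add_sub_cancel_left, cs.prod_alternatingWord_eq_mul_pow]
        have h₁ : (2 * (M i j + l) + 1) / 2 = M i j + l := by omega
        have h₂ : (2 * l + 1) / 2 = l := by omega
        rw [h₁, h₂, pow_add, cs.simple_mul_simple_pow']
        simp
  rw [hlist, List.count_append]
  exact ⟨_, rfl⟩

theorem signedConj_isLiftable (cs : CoxeterSystem M W) : M.IsLiftable (signedConj cs) := by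
  intro j i
  have hword (m : ℕ) : (signedConj cs j * signedConj cs i) ^ m =
      ((CoxeterSystem.alternatingWord i j (2 * m)).reverse.map (signedConj cs)).prod := by
    induction m with
    | zero => simp [CoxeterSystem.alternatingWord]
    | succ m ih =>
      rw [pow_succ', ih, Nat.mul_succ, CoxeterSystem.alternatingWord_succ,
        CoxeterSystem.alternatingWord_succ]
      simp [mul_assoc]
  rw [hword, M.symmetric j i]
  funext ⟨t, e⟩
  rw [prod_signedConj_reverse, (ZMod.natCast_eq_zero_iff_even).mpr
    (even_count_leftInvSeq_alternatingWord cs i j t), cs.prod_alternatingWord_eq_mul_pow]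
  simp
  rfl

theorem count_leftInvSeq_of_wordProd_eq (cs : CoxeterSystem M W) {ω ω' : List B}
    (h : cs.wordProd ω = cs.wordProd ω') (t : W) :
    ((cs.leftInvSeq ω).count t : ZMod 2) = (cs.leftInvSeq ω').count t := by
  have hlift (ω : List B) : cs.lift ⟨signedConj cs, signedConj_isLiftable cs⟩ (cs.wordProd ω)⁻¹ =
      (ω.reverse.map (signedConj cs)).prod := by
    rw [← cs.wordProd_reverse, CoxeterSystem.wordProd, map_list_prod, List.map_map]
    congr 2
    funext i
    exact cs.lift_apply_simple _ i
  have key := congrArg (fun f : Function.End (W × ZMod 2) => (f (t, 0)).2)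
    ((hlift ω).symm.trans ((congrArg _ (congrArg _ h)).trans (hlift ω')))
  simpa only [prod_signedConj_reverse, zero_add] using key

/-- The exchange property: a left descent of `w` occurs in the left inversion sequence of every
word for `w`. -/
theorem simple_mem_leftInvSeq (cs : CoxeterSystem M W) {ω : List B} {i : B}
    (h : cs.IsLeftDescent (cs.wordProd ω) i) : cs.simple i ∈ cs.leftInvSeq ω := by
  by_contra hmem
  obtain ⟨ω', hω', hprod⟩ := cs.exists_isReduced (cs.simple i * cs.wordProd ω)
  have hcount := count_leftInvSeq_of_wordProd_eq cs (ω := i :: ω') (ω' := ω)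
    (by rw [cs.wordProd_cons, ← hprod]; simp) (cs.simple i)
  rw [List.count_eq_zero_of_not_mem hmem] at hcount
  have hmem' : cs.simple i ∈ cs.leftInvSeq ω' := by
    by_contra hmem'
    have hmap : cs.simple i ∉ List.map (MulAut.conj (cs.simple i)) (cs.leftInvSeq ω') := by
      intro hx
      obtain ⟨t, ht, hti⟩ := List.mem_map.mp hx
      have : t = cs.simple i := by
        apply (MulAut.conj (cs.simple i)).injective
        rw [hti]; simp
      exact hmem' (this ▸ ht)
    rw [CoxeterSystem.leftInvSeq, List.count_cons_self, List.count_eq_zero_of_not_mem hmap] at hcount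
    simp at hcount
  have hlt := (cs.isLeftInversion_of_mem_leftInvSeq hω' hmem').2
  rw [← hprod, cs.simple_mul_simple_cancel_left] at hlt
  exact lt_asymm hlt h

theorem simple_mul_eq_mul_simple (cs : CoxeterSystem M W) {u i : B} {g : W}
    (hg : g ∈ Hp cs u) (hgi : g * cs.simple i ∈ Hm cs u) :
    cs.simple u * g = g * cs.simple i := by
  obtain ⟨ω, hω, rfl⟩ := cs.exists_isReduced g
  rw [← cs.wordProd_concat] at hgi
  have hmem := simple_mem_leftInvSeq cs hgi
  rw [cs.leftInvSeq_concat, List.concat_eq_append, List.mem_append, List.mem_singleton] at hmem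
  rcases hmem with hmem | heq
  · exact absurd (cs.isLeftInversion_of_mem_leftInvSeq hω hmem).2 (not_lt_of_gt hg)
  · rw [heq]; group

theorem simple_mul_mem_Hm (cs : CoxeterSystem M W) {u i : B} {y : W}
    (hne : cs.simple i ≠ cs.simple u) (hu : y ∈ Hm cs u) (hi : y ∈ Hm cs i) :
    cs.simple i * y ∈ Hm cs u := by
  obtain ⟨ω, hω, hprod⟩ := cs.exists_isReduced (cs.simple u * y)
  have hy : y = cs.wordProd (u :: ω) := by rw [cs.wordProd_cons, ← hprod]; simp
  have hmem : cs.simple i ∈ cs.leftInvSeq (u :: ω) := simple_mem_leftInvSeq cs (hy ▸ hi)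
  obtain ⟨j, hj, hji⟩ := List.mem_iff_getElem.mp hmem
  have herase := cs.getD_leftInvSeq_mul_wordProd (u :: ω) j
  rw [List.getD_eq_getElem _ _ hj, hji, ← hy] at herase
  rcases j with _ | j
  · exact absurd hji.symm hne
  have hjω : j < ω.length := by simpa using hj
  have hlen := cs.length_wordProd_le (ω.eraseIdx j)
  have hlen' := List.length_eraseIdx_add_one hjω
  have hred : cs.length (cs.simple u * y) = ω.length := hprod ▸ hω
  have h₁ := cs.isLeftDescent_iff.mp hu
  have h₂ := cs.isLeftDescent_iff.mp hi
  rw [Hm, Set.mem_ofPred_eq, herase, List.eraseIdx_cons_succ, cs.wordProd_cons,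
    cs.simple_mul_simple_cancel_left, ← cs.wordProd_cons, ← List.eraseIdx_cons_succ, ← herase]
  omega

theorem smul_ssubset_smul_iff {g : W} {A A' : Set W} : g • A ⊂ g • A' ↔ A ⊂ A' := by
  simp only [ssubset_iff_subset_not_subset, Set.smul_set_subset_smul_set_iff]

theorem compl_Hp (cs : CoxeterSystem M W) (u : B) : (Hp cs u)ᶜ = Hm cs u := by
  ext g
  have := cs.length_simple_mul_ne g u
  simp only [Hp, Hm, Set.mem_compl_iff, Set.mem_ofPred_eq]
  omega

theorem compl_Hm (cs : CoxeterSystem M W) (u : B) : (Hm cs u)ᶜ = Hp cs u := by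
  rw [← compl_Hp, compl_compl]

theorem simple_smul_Hp (cs : CoxeterSystem M W) (u : B) : cs.simple u • Hp cs u = Hm cs u := by
  ext g
  rw [Set.mem_smul_set_iff_inv_smul_mem]
  simp [Hp, Hm]

theorem smul_Hm_of_smul_Hp (cs : CoxeterSystem M W) {u : B} {g : W}
    (h : g • Hp cs u = Hp cs u) : g • Hm cs u = Hm cs u := by
  rw [← compl_Hp, Set.smul_set_compl, h]

theorem one_mem_Hp (cs : CoxeterSystem M W) (u : B) : (1 : W) ∈ Hp cs u := by
  simp [Hp]

theorem simple_mem_Hm (cs : CoxeterSystem M W) (u : B) : cs.simple u ∈ Hm cs u := by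
  simp [Hm]

theorem simple_smul_Hp_of_isLeftDescent (cs : CoxeterSystem M W) {u i : B} (hnest : Nested cs u)
    {v : W} (hv : v • Hp cs u = Hp cs u) (hi : cs.IsLeftDescent v i) :
    cs.simple i • Hp cs u = Hp cs u := by
  have hvp : v ∈ Hp cs u := by
    have := Set.smul_mem_smul_set (a := v) (one_mem_Hp cs u)
    simpa [hv] using this
  have hvu : v * cs.simple u ∈ Hm cs u := by
    have := Set.smul_mem_smul_set (a := v) (simple_mem_Hm cs u)
    simpa [smul_Hm_of_smul_Hp cs hv] using this
  have hcomm := simple_mul_eq_mul_simple cs hvp hvu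
  have hne : cs.simple i ≠ cs.simple u := by
    intro h
    rw [CoxeterSystem.IsLeftDescent, h] at hi
    exact lt_asymm hi hvp
  have hlt : cs.length v < cs.length (v * cs.simple u) := hcomm ▸ hvp
  have hvui : v * cs.simple u ∈ Hm cs i := by
    have h₁ := cs.length_mul_le (cs.simple i * v) (cs.simple u)
    rw [cs.length_simple, mul_assoc] at h₁
    have h₂ := cs.isLeftDescent_iff.mp hi
    simp only [Hm, Set.mem_ofPred_eq]
    omega
  have hbad := simple_mul_mem_Hm cs hne hvu hvui
  have hip : cs.simple i ∈ Hp cs u := by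
    rw [← compl_Hm]
    intro h
    rw [Hm, Set.mem_ofPred_eq, cs.length_simple, Nat.lt_one_iff, cs.length_eq_zero_iff] at h
    exact hne (by simpa using (eq_inv_of_mul_eq_one_right h))
  have hone : (1 : W) ∈ cs.simple i • Hp cs u := by
    rw [Set.mem_smul_set_iff_inv_smul_mem]; simpa using hip
  have hone' : (1 : W) ∉ Hm cs u := by
    rw [← compl_Hp]; exact fun h => h (one_mem_Hp cs u)
  have hinv {A : Set W} (h : cs.simple i • A ⊂ A) : False := by
    have h' : cs.simple i • (cs.simple i • A) ⊆ cs.simple i • A := Set.smul_set_mono h.subset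
    rw [smul_smul, cs.simple_mul_simple_self, one_smul] at h'
    exact h.not_subset h'
  rcases hnest (cs.simple i) with h | h | h | h | h | h
  · exact h
  · exact absurd (h ▸ hone) hone'
  · exact (hinv h).elim
  · exact absurd (h.subset hone) hone'
  · have hmem : v * cs.simple u ∈ cs.simple i • Hm cs u := by
      rw [Set.mem_smul_set_iff_inv_smul_mem]; simpa using hbad
    have := h.subset hmem
    rw [← compl_Hm] at this
    exact absurd hvu this
  · exact (hinv h).elim

theorem mem_Hp_of_smul_ssubset (cs : CoxeterSystem M W) {u : B} {w : W} {A : Set W}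
    (hA : A = Hp cs u ∨ A = Hm cs u) (h : w • A ⊂ Hp cs u) : w ∈ Hp cs u := by
  rcases hA with rfl | rfl
  · simpa using h.subset (Set.smul_mem_smul_set (a := w) (one_mem_Hp cs u))
  · have hwu : w * cs.simple u ∈ Hp cs u := by
      simpa using h.subset (Set.smul_mem_smul_set (a := w) (simple_mem_Hm cs u))
    rw [← compl_Hm]
    intro hw
    have hcomm := simple_mul_eq_mul_simple cs hwu (i := u) (by simpa using hw)
    have hcomm' : cs.simple u * w = w * cs.simple u := by
      apply mul_right_cancel (b := cs.simple u)
      rw [mul_assoc, hcomm]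
    have h₁ : w • Hp cs u ⊆ Hm cs u := by
      have h₂ : cs.simple u • (w • Hm cs u) ⊆ cs.simple u • Hp cs u :=
        Set.smul_set_mono h.subset
      rwa [smul_smul, hcomm', ← smul_smul, ← simple_smul_Hp, smul_smul (cs.simple u),
        cs.simple_mul_simple_self, one_smul, simple_smul_Hp] at h₂
    refine h.not_subset ?_
    have h₃ := Set.compl_subset_compl.mpr h₁
    rwa [compl_Hm, ← Set.smul_set_compl, compl_Hp] at h₃

theorem smul_ssubset_Hm_of_isBuilding (cs : CoxeterSystem M W) {u : B} (hnest : Nested cs u)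
    {Δ : Type*} {d : Δ → Δ → W} (hb : IsBuilding cs Δ d) {C D : Δ} {A : Set W}
    (hDC : d D C ∈ Hp cs u) (hA : d D C • A ⊂ Hp cs u) {v : W} (hv : v • Hp cs u = Hp cs u)
    {E : Δ} (hE : d E D = v * cs.simple u) : d E C • A ⊂ Hm cs u := by
  obtain ⟨-, -, hb₂, hb₃⟩ := hb
  induction hn : cs.length v generalizing v E with
  | zero =>
    rw [cs.length_eq_zero_iff] at hn
    rw [hn, one_mul] at hE
    rw [(hb₂ D C E u hE).2 hDC, mul_smul, ← simple_smul_Hp]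
    exact smul_ssubset_smul_iff.mpr hA
  | succ n ih =>
    obtain ⟨i, hi⟩ := cs.exists_leftDescent_of_ne_one (w := v) (by rintro rfl; simp at hn)
    have hstab := simple_smul_Hp_of_isLeftDescent cs hnest hv hi
    obtain ⟨E', hE'E, hE'D⟩ := hb₃ E D i
    have hE'C := ih (v := cs.simple i * v) (E := E') (by rw [mul_smul, hv, hstab])
      (by rw [hE'D, hE, mul_assoc]) (by have := cs.isLeftDescent_iff.mp hi; omega)
    rcases (hb₂ E C E' i hE'E).1 with h | h
    · rw [h, mul_smul, ← smul_Hm_of_smul_Hp cs hstab] at hE'C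
      exact smul_ssubset_smul_iff.mp hE'C
    · rwa [h] at hE'C

/-- Transitivity of root inclusions in a building satisfying the nested condition, case (iv). -/
theorem root_inclusion_transitivity_flip_right (cs : CoxeterSystem M W) (u : B) (hnest : Nested cs u)
    {Δ : Type*} (d : Δ → Δ → W) (hb : IsBuilding cs Δ d)
    (φ φ₁ φ₂ : W → Δ) (hφ : IsIsom d φ) (hφ₁ : IsIsom d φ₁) (hφ₂ : IsIsom d φ₂)
    (C D E : Δ) (w w₁ w₂ : W)
    (hD : φ 1 = D) (hD₁ : φ₁ 1 = D) (hC : φ w = C) (hE₁ : φ₁ w₁ = E)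
    (hC₂ : φ₂ 1 = C) (hE₂ : φ₂ w₂ = E)
    (A : Set W) (hA : A = Hp cs u ∨ A = Hm cs u)
    (h₁ : w • A ⊂ Hp cs u) (h₂ : Hp cs u = w₁ • Hm cs u) :
    A ⊂ w₂ • Hm cs u := by
  have hDC : d D C = w := by rw [← hD, ← hC, hφ]; simp
  have hED : d E D = w₁⁻¹ * cs.simple u * cs.simple u := by
    rw [← hD₁, ← hE₁, hφ₁]; simp
  have hEC : d E C = w₂⁻¹ := by rw [← hC₂, ← hE₂, hφ₂]; simp
  have hstab : (w₁⁻¹ * cs.simple u) • Hp cs u = Hp cs u := by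
    have h₃ : Hm cs u = w₁ • Hp cs u := by
      rw [← compl_Hm, Set.smul_set_compl, ← h₂, compl_Hp]
    rw [mul_smul, simple_smul_Hp, h₃, inv_smul_smul]
  have key := smul_ssubset_Hm_of_isBuilding cs hnest hb (A := A)
    (by rw [hDC]; exact mem_Hp_of_smul_ssubset cs hA h₁) (by rwa [hDC]) hstab hED
  rw [hEC] at key
  have := (smul_ssubset_smul_iff (g := w₂)).mpr key
  rwa [smul_inv_smul] at this
end

section
/- Let (Δ,δ) be a building of type (W,S) where W satisfies the nested condition relative to u ∈ S, let G be a group acting isometrically on Δ, and fix a chamber C₀ ∈ Δ. With T_u := {s ∈ S : m_{su} = 2}, W_{T_u} the subgroup generated by T_u, and G₀ := {g ∈ G : δ(C₀, g•C₀) ∈ W_{T_u}}, the multiplier m_G^u satisfies the Cotlar identity relative to G₀: for every g ∈ G \ G₀ and every h ∈ G, (m_G^u(g) − m_G^u(h))·(m_G^u(g⁻¹h) − m_G^u(g⁻¹)) = 0. -/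
open Pointwise
open scoped Classical

variable {B : Type*} {W : Type*} [Group W] {M : CoxeterMatrix B}

/-- The parabolic subgroup `W_{T_u}` where `T_u = {s ∈ S : m_{su} = 2}`. -/
def WTu (cs : CoxeterSystem M W) (u : B) : Subgroup W :=
  Subgroup.closure (cs.simple '' {j : B | M j u = 2})

/-- The multiplier `m_G^u` for a group `G` acting on the building. -/
noncomputable def mG {G : Type*} [Group G] (cs : CoxeterSystem M W) {Δ : Type*}
    (d : Δ → Δ → W) [MulAction G Δ] (C₀ : Δ) (u : B) (g : G) : ℤ :=
  if cs.length (d C₀ (g • C₀)) < cs.length (cs.simple u * d C₀ (g • C₀)) then 1 else -1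

namespace CoxeterMatrix

/-- The coroot of `i` in the geometric representation. -/
noncomputable def coroot (M : CoxeterMatrix B) (i : B) : Module.Dual ℝ (B →₀ ℝ) :=
  Finsupp.linearCombination ℝ fun j ↦ -2 * Real.cos (Real.pi / M i j)

theorem coroot_single (M : CoxeterMatrix B) (i j : B) :
    M.coroot i (Finsupp.single j 1) = -2 * Real.cos (Real.pi / M i j) := by
  simp [coroot]

theorem coroot_single_self (M : CoxeterMatrix B) (i : B) :
    M.coroot i (Finsupp.single i 1) = 2 := by
  simp [coroot_single]

theorem isLiftable_reflection (M : CoxeterMatrix B) :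
    M.IsLiftable fun i ↦ Module.reflection (M.coroot_single_self i) := by
  intro i j
  obtain h0 | h1 | h2 | h3 : M i j = 0 ∨ M i j = 1 ∨ M i j = 2 ∨ 3 ≤ M i j := by lia
  · rw [h0, pow_zero]
  · have hij : i = j := by
      by_contra h
      exact M.off_diagonal i j h h1
    subst hij
    rw [h1, pow_one]
    ext1 z
    exact Module.involutive_reflection (M.coroot_single_self i) z
  · ext1 z
    have hij : M.coroot i (Finsupp.single j 1) = 0 := by simp [coroot_single, h2]
    have hji : M.coroot j (Finsupp.single i 1) = 0 := by simp [coroot_single, M.symmetric j i, h2]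
    rw [h2, Module.reflection_mul_reflection_pow_apply]
    simp only [hij, hji]
    norm_num
    abel
  · ext1 z
    set m := M i j with hm
    set θ : ℝ := 2 * (Real.pi / m) with hθ
    have hm0 : (0 : ℝ) < m := by
      have : 0 < m := by lia
      exact_mod_cast this
    have hmθ : m * θ = 2 * Real.pi := by
      rw [hθ]; field_simp
    have hsin : Real.sin θ ≠ 0 := by
      apply ne_of_gt
      apply Real.sin_pos_of_pos_of_lt_pi
      · have := Real.pi_pos
        positivity
      · have h3' : (3 : ℝ) ≤ m := by exact_mod_cast h3
        have := Real.pi_pos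
        have h4 : 0 ≤ θ := by positivity
        nlinarith
    have ht : 2 * Real.cos θ = M.coroot i (Finsupp.single j 1) * M.coroot j (Finsupp.single i 1) - 2 := by
      rw [coroot_single, coroot_single, M.symmetric j i, ← hm, hθ, Real.cos_two_mul]
      ring
    have hS (n : ℤ) := Polynomial.Chebyshev.S_two_mul_real_cos θ n
    rw [Module.reflection_mul_reflection_pow_apply _ _ _ _ _ ht]
    obtain ⟨k, hk | hk⟩ := Nat.even_or_odd' m
    · have h1 : ((m : ℤ) - 2) / 2 = k - 1 := by lia
      have h2 : ((m : ℤ) - 1) / 2 = k - 1 := by lia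
      have hz : (Polynomial.Chebyshev.S ℝ ((k : ℤ) - 1)).eval (2 * Real.cos θ) = 0 := by
        have := hS ((k : ℤ) - 1)
        have hkθ : (k : ℝ) * θ = Real.pi := by
          rw [hk] at hmθ
          push_cast at hmθ
          linarith
        push_cast at this
        rw [sub_add_cancel, hkθ, Real.sin_pi] at this
        exact (mul_eq_zero.mp this).resolve_right hsin
      rw [h1, h2, hz]
      simp
    · have h1 : ((m : ℤ) - 2) / 2 = k - 1 := by lia
      have h2 : ((m : ℤ) - 1) / 2 = k := by lia
      have h3 : ((m : ℤ) - 3) / 2 = k - 1 := by lia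
      have h4 : (m : ℤ) / 2 = k := by lia
      have hz : (Polynomial.Chebyshev.S ℝ (k : ℤ)).eval (2 * Real.cos θ) +
          (Polynomial.Chebyshev.S ℝ ((k : ℤ) - 1)).eval (2 * Real.cos θ) = 0 := by
        have e1 := hS (k : ℤ)
        have e2 := hS ((k : ℤ) - 1)
        have hkθ : ((k : ℝ) + 1) * θ = 2 * Real.pi - k * θ := by
          rw [hk] at hmθ
          push_cast at hmθ
          linarith
        push_cast at e1 e2
        rw [hkθ, Real.sin_two_pi_sub] at e1
        rw [sub_add_cancel] at e2
        exact (mul_eq_zero.mp (by rw [add_mul, e1, e2, neg_add_cancel])).resolve_right hsin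
      rw [h1, h2, h3, h4, hz]
      simp

end CoxeterMatrix

namespace CoxeterSystem

theorem coxeterMatrix_eq_two_of_commute (cs : CoxeterSystem M W) {i j : B} (hij : i ≠ j)
    (h : Commute (cs.simple i) (cs.simple j)) : M i j = 2 := by
  have h' := (h.map (cs.lift ⟨_, M.isLiftable_reflection⟩)).eq
  rw [lift_apply_simple, lift_apply_simple] at h'
  have h2 := DFunLike.congr_fun (DFunLike.congr_fun h' (Finsupp.single j 1)) i
  simp only [LinearEquiv.mul_apply, Module.reflection_apply, map_sub, map_smul,
    CoxeterMatrix.coroot_single, M.symmetric j i] at h2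
  simp [hij] at h2
  have hc : Real.cos (Real.pi / M i j) = 0 := by linarith
  by_contra hM
  have h1 : M i j ≠ 1 := M.off_diagonal i j hij
  obtain h0 | h3 : M i j = 0 ∨ 3 ≤ M i j := by lia
  · simp [h0] at hc
  · have h3' : (3 : ℝ) ≤ M i j := by exact_mod_cast h3
    have := Real.pi_pos
    refine (Real.cos_pos_of_mem_Ioo ⟨?_, ?_⟩).ne' hc
    · have : 0 < Real.pi / M i j := by positivity
      linarith
    · rw [div_lt_div_iff₀ (by linarith) two_pos]
      nlinarith

theorem simple_ne_simple_of_ne (cs : CoxeterSystem M W) {i j : B} (hij : i ≠ j) :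
    cs.simple i ≠ cs.simple j := by
  intro h
  have h' := congrArg (cs.lift ⟨_, M.isLiftable_reflection⟩) h
  rw [lift_apply_simple, lift_apply_simple] at h'
  have h2 := DFunLike.congr_fun (DFunLike.congr_fun h' (Finsupp.single j 1)) j
  simp only [Module.reflection_apply, CoxeterMatrix.coroot_single] at h2
  simp [hij] at h2
  norm_num at h2

/-- The map `(t, ε) ↦ (s t s, ε + [t = s])`, where `s` is the simple reflection indexed by `i`. -/
noncomputable def inversionStep (cs : CoxeterSystem M W) (i : B) : Function.End (W × ZMod 2) :=
  fun p ↦ (cs.simple i * p.1 * cs.simple i, p.2 + if p.1 = cs.simple i then 1 else 0)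

theorem inversionStep_mul_pow_apply (cs : CoxeterSystem M W) (i j : B) (n : ℕ) (t : W)
    (ε : ZMod 2) :
    ((cs.inversionStep i * cs.inversionStep j) ^ n) (t, ε) =
      ((cs.simple i * cs.simple j) ^ n * t * ((cs.simple i * cs.simple j) ^ n)⁻¹,
        ε + ∑ k ∈ Finset.range (2 * n),
          if t = cs.simple j * (cs.simple i * cs.simple j) ^ k then 1 else 0) := by
  induction n with
  | zero => simp; rfl
  | succ n ih =>
    have hconj (k : ℕ) : cs.simple j * (cs.simple i * cs.simple j) ^ k =
        ((cs.simple i * cs.simple j) ^ k)⁻¹ * cs.simple j := by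
      have h : SemiconjBy (cs.simple j) (cs.simple i * cs.simple j)
          (cs.simple i * cs.simple j)⁻¹ := by simp [SemiconjBy, mul_assoc]
      rw [← inv_pow]
      exact (h.pow_right k).eq
    rw [pow_succ']
    change cs.inversionStep i (cs.inversionStep j (((cs.inversionStep i * cs.inversionStep j) ^ n)
      (t, ε))) = _
    rw [ih]
    set c := cs.simple i * cs.simple j with hc
    have h1 : c ^ n * t * (c ^ n)⁻¹ = cs.simple j ↔ t = cs.simple j * c ^ (2 * n) := by
      rw [two_mul, pow_add, ← mul_assoc, hconj, mul_inv_eq_iff_eq_mul, ← eq_inv_mul_iff_mul_eq,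
        mul_assoc]
    have h2 : cs.simple j * (c ^ n * t * (c ^ n)⁻¹) * cs.simple j = cs.simple i ↔
        t = cs.simple j * c ^ (2 * n + 1) := by
      have h : cs.simple j * c ^ (2 * n + 1) = (c ^ n)⁻¹ * (cs.simple j * c) * c ^ n := by
        rw [show 2 * n + 1 = n + (1 + n) by ring, pow_add, pow_add, pow_one, ← mul_assoc, hconj]
        simp only [mul_assoc]
      have hjc : cs.simple j * c = cs.simple j * cs.simple i * cs.simple j := by
        simp [hc, mul_assoc]
      rw [h, hjc]
      clear_value c
      constructor
      · intro h
        rw [← h]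
        simp [mul_assoc]
      · intro h
        rw [h]
        simp [mul_assoc]
    simp only [inversionStep, h1, h2]
    rw [show 2 * (n + 1) = 2 * n + 1 + 1 by ring, Finset.sum_range_succ, Finset.sum_range_succ,
      pow_succ']
    ext1
    · simp [hc, pow_succ', mul_assoc]
    · simp [add_assoc]

theorem isLiftable_inversionStep (cs : CoxeterSystem M W) : M.IsLiftable cs.inversionStep := by
  intro i j
  funext ⟨t, ε⟩
  rw [inversionStep_mul_pow_apply, cs.simple_mul_simple_pow, two_mul, Finset.sum_range_add]
  simp only [pow_add, cs.simple_mul_simple_pow, one_mul]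
  rw [CharTwo.add_self_eq_zero]
  simp
  rfl

/-- The parity of the number of occurrences of `t` in the right inversion sequence of any word
for `w`. -/
noncomputable def inversionParity (cs : CoxeterSystem M W) (w t : W) : ZMod 2 :=
  (cs.lift ⟨_, cs.isLiftable_inversionStep⟩ w (t, 0)).2

theorem lift_inversionStep_wordProd (cs : CoxeterSystem M W) (ω : List B) (t : W) (ε : ZMod 2) :
    cs.lift ⟨_, cs.isLiftable_inversionStep⟩ (cs.wordProd ω) (t, ε) =
      (cs.wordProd ω * t * (cs.wordProd ω)⁻¹, ε + ((cs.rightInvSeq ω).count t : ZMod 2)) := by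
  induction ω with
  | nil => simp; rfl
  | cons i ω ih =>
    rw [wordProd_cons, map_mul, lift_apply_simple]
    change cs.inversionStep i (cs.lift ⟨_, cs.isLiftable_inversionStep⟩ (cs.wordProd ω) (t, ε)) = _
    rw [ih]
    have h : cs.wordProd ω * t * (cs.wordProd ω)⁻¹ = cs.simple i ↔
        (cs.wordProd ω)⁻¹ * cs.simple i * cs.wordProd ω = t := by
      rw [mul_inv_eq_iff_eq_mul, ← eq_inv_mul_iff_mul_eq, mul_assoc, eq_comm]
    simp only [inversionStep, h, rightInvSeq, List.count_cons, beq_iff_eq]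
    ext1
    · simp [mul_assoc]
    · push_cast
      simp [add_assoc]

theorem inversionParity_wordProd (cs : CoxeterSystem M W) (ω : List B) (t : W) :
    cs.inversionParity (cs.wordProd ω) t = (cs.rightInvSeq ω).count t := by
  simp [inversionParity, lift_inversionStep_wordProd]

theorem inversionParity_mul (cs : CoxeterSystem M W) (w w' t : W) :
    cs.inversionParity (w * w') t =
      cs.inversionParity w' t + cs.inversionParity w (w' * t * w'⁻¹) := by
  obtain ⟨ω, rfl⟩ := cs.wordProd_surjective w
  obtain ⟨ω', rfl⟩ := cs.wordProd_surjective w'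
  rw [inversionParity, map_mul]
  change (cs.lift ⟨_, cs.isLiftable_inversionStep⟩ (cs.wordProd ω)
    (cs.lift ⟨_, cs.isLiftable_inversionStep⟩ (cs.wordProd ω') (t, 0))).2 = _
  rw [lift_inversionStep_wordProd, lift_inversionStep_wordProd, inversionParity_wordProd,
    inversionParity_wordProd, zero_add]

theorem inversionParity_simple (cs : CoxeterSystem M W) (i : B) (t : W) :
    cs.inversionParity (cs.simple i) t = if t = cs.simple i then 1 else 0 := by
  have h := cs.inversionParity_wordProd [i] t
  rw [wordProd_singleton] at h
  rw [h]
  simp only [rightInvSeq_singleton, List.count_singleton, beq_iff_eq, eq_comm (a := t)]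
  split_ifs <;> simp

theorem exists_eraseIdx_of_inversionParity_ne_zero (cs : CoxeterSystem M W) {ω : List B} {t : W}
    (h : cs.inversionParity (cs.wordProd ω) t ≠ 0) :
    ∃ k < ω.length, cs.wordProd ω * t = cs.wordProd (ω.eraseIdx k) := by
  rw [inversionParity_wordProd] at h
  have hmem : t ∈ cs.rightInvSeq ω := by
    by_contra hn
    exact h (by simp [List.count_eq_zero_of_not_mem hn])
  obtain ⟨k, hk, rfl⟩ := List.mem_iff_getElem.mp hmem
  refine ⟨k, by simpa using hk, ?_⟩
  rw [← List.getD_eq_getElem _ 1 hk, wordProd_mul_getD_rightInvSeq]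

theorem length_mul_lt_of_inversionParity_ne_zero (cs : CoxeterSystem M W) {w t : W}
    (h : cs.inversionParity w t ≠ 0) : cs.length (w * t) < cs.length w := by
  obtain ⟨ω, hω, rfl⟩ := cs.exists_isReduced w
  obtain ⟨k, hk, he⟩ := cs.exists_eraseIdx_of_inversionParity_ne_zero h
  rw [he, hω.eq]
  have := cs.length_wordProd_le (ω.eraseIdx k)
  have := List.length_eraseIdx_add_one hk
  lia

theorem isRightDescent_iff_inversionParity (cs : CoxeterSystem M W) (w : W) (i : B) :
    cs.IsRightDescent w i ↔ cs.inversionParity w (cs.simple i) = 1 := by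
  constructor
  · intro h
    by_contra h1
    have h0 : cs.inversionParity w (cs.simple i) = 0 := by
      generalize cs.inversionParity w (cs.simple i) = a at h1
      revert a
      decide
    have := cs.length_mul_lt_of_inversionParity_ne_zero (w := w * cs.simple i)
      (t := cs.simple i) (by simp [inversionParity_mul, inversionParity_simple, h0])
    rw [simple_mul_simple_cancel_right] at this
    exact lt_asymm h this
  · intro h
    exact cs.length_mul_lt_of_inversionParity_ne_zero (by simp [h])

theorem isLeftDescent_iff_inversionParity (cs : CoxeterSystem M W) (w : W) (i : B) :
    cs.IsLeftDescent w i ↔ cs.inversionParity w⁻¹ (cs.simple i) = 1 := by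
  rw [← isRightDescent_iff_inversionParity, isRightDescent_inv_iff]

/-- If `s_i` is a left descent of `w s_j` but not of `w`, then `s_i w = w s_j`. -/
theorem simple_mul_eq_mul_simple (cs : CoxeterSystem M W) {w : W} {i j : B}
    (h : ¬ cs.IsLeftDescent w i) (h' : cs.IsLeftDescent (w * cs.simple j) i) :
    cs.simple i * w = w * cs.simple j := by
  rw [isLeftDescent_iff_inversionParity] at h h'
  rw [mul_inv_rev, inversionParity_mul, inv_simple, inversionParity_simple] at h'
  by_contra hne
  rw [if_neg, add_zero] at h'
  · exact h h'
  · intro he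
    apply hne
    rw [← he]
    group

/-- Left multiplication by a simple reflection commuting with `s_i` preserves the left descent
at `i`. -/
theorem isLeftDescent_simple_mul_iff (cs : CoxeterSystem M W) {i j : B}
    (hij : cs.simple i ≠ cs.simple j) (h : Commute (cs.simple i) (cs.simple j)) (w : W) :
    cs.IsLeftDescent (cs.simple j * w) i ↔ cs.IsLeftDescent w i := by
  rw [isLeftDescent_iff_inversionParity, isLeftDescent_iff_inversionParity, mul_inv_rev,
    inversionParity_mul, inv_simple, inversionParity_simple, if_neg hij, inv_simple, ← h.eq,
    simple_mul_simple_cancel_right, zero_add]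

/-- The standard parabolic subgroup generated by the simple reflections with index in `I`. -/
def parabolic (cs : CoxeterSystem M W) (I : Set B) : Subgroup W :=
  Subgroup.closure (cs.simple '' I)

theorem simple_mem_parabolic (cs : CoxeterSystem M W) {I : Set B} {i : B} (hi : i ∈ I) :
    cs.simple i ∈ cs.parabolic I :=
  Subgroup.subset_closure (Set.mem_image_of_mem _ hi)

theorem parabolic_mono (cs : CoxeterSystem M W) {I J : Set B} (h : I ⊆ J) :
    cs.parabolic I ≤ cs.parabolic J :=
  Subgroup.closure_mono (Set.image_mono h)

theorem wordProd_mem_parabolic (cs : CoxeterSystem M W) {I : Set B} {ω : List B}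
    (hω : ∀ i ∈ ω, i ∈ I) : cs.wordProd ω ∈ cs.parabolic I := by
  induction ω with
  | nil => simp [one_mem]
  | cons i ω ih =>
    rw [wordProd_cons]
    exact mul_mem (cs.simple_mem_parabolic (hω i (by simp)))
      (ih fun j hj ↦ hω j (List.mem_cons_of_mem _ hj))

theorem exists_word_of_mem_parabolic (cs : CoxeterSystem M W) {I : Set B} {a : W}
    (ha : a ∈ cs.parabolic I) : ∃ ω : List B, (∀ i ∈ ω, i ∈ I) ∧ cs.wordProd ω = a := by
  induction ha using Subgroup.closure_induction with
  | mem x hx =>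
    obtain ⟨i, hi, rfl⟩ := hx
    exact ⟨[i], by simpa using hi, by simp⟩
  | one => exact ⟨[], by simp, by simp⟩
  | mul x y _ _ hx hy =>
    obtain ⟨ω, hω, rfl⟩ := hx
    obtain ⟨ω', hω', rfl⟩ := hy
    refine ⟨ω ++ ω', fun i hi ↦ ?_, by rw [wordProd_append]⟩
    rcases List.mem_append.mp hi with h | h
    exacts [hω i h, hω' i h]
  | inv x _ hx =>
    obtain ⟨ω, hω, rfl⟩ := hx
    exact ⟨ω.reverse, by simpa using hω, by rw [wordProd_reverse]⟩

theorem inversionParity_inv_eq_zero_of_minimal (cs : CoxeterSystem M W) {I : Set B} {v t : W}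
    (hv : ∀ a ∈ cs.parabolic I, cs.length v ≤ cs.length (a * v)) (ht : t ∈ cs.parabolic I) :
    cs.inversionParity v⁻¹ t = 0 := by
  by_contra h
  have := cs.length_mul_lt_of_inversionParity_ne_zero h
  have h' := hv t⁻¹ (inv_mem ht)
  rw [← cs.length_inv (t⁻¹ * v), mul_inv_rev, inv_inv] at h'
  rw [cs.length_inv] at this
  lia

theorem length_wordProd_mul_of_minimal (cs : CoxeterSystem M W) {I : Set B} {v : W}
    (hv : ∀ a ∈ cs.parabolic I, cs.length v ≤ cs.length (a * v)) {ω : List B}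
    (hω : ∀ i ∈ ω, i ∈ I)
    (hmin : ∀ ω' : List B, (∀ i ∈ ω', i ∈ I) → cs.wordProd ω' = cs.wordProd ω →
      ω.length ≤ ω'.length) :
    cs.length (cs.wordProd ω * v) = ω.length + cs.length v := by
  induction ω with
  | nil => simp
  | cons i ω ih =>
    have hi : i ∈ I := hω i (by simp)
    have hω₀ : ∀ j ∈ ω, j ∈ I := fun j hj ↦ hω j (List.mem_cons_of_mem _ hj)
    have hlen := ih hω₀ fun ω' h h' ↦ by
      have := hmin (i :: ω') (by simpa [hi] using h) (by rw [wordProd_cons, wordProd_cons, h'])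
      simpa using this
    rw [wordProd_cons, mul_assoc]
    by_cases hd : cs.IsLeftDescent (cs.wordProd ω * v) i
    · exfalso
      rw [isLeftDescent_iff_inversionParity, mul_inv_rev, inversionParity_mul, inv_inv,
        cs.inversionParity_inv_eq_zero_of_minimal hv, add_zero, ← wordProd_reverse] at hd
      · obtain ⟨k, hk, he⟩ := cs.exists_eraseIdx_of_inversionParity_ne_zero
          (ω := ω.reverse) (t := cs.simple i) (by rw [hd]; exact one_ne_zero)
        have := hmin (ω.reverse.eraseIdx k).reverse
          (fun j hj ↦ hω₀ j (by simpa using List.mem_of_mem_eraseIdx (List.mem_reverse.mp hj)))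
          (by rw [wordProd_reverse, ← he, mul_inv_rev, wordProd_reverse, wordProd_cons]; simp)
        have := List.length_eraseIdx_add_one hk
        simp only [List.length_reverse, List.length_cons] at *
        lia
      · exact mul_mem (mul_mem (inv_mem (cs.wordProd_mem_parabolic hω₀))
          (cs.simple_mem_parabolic hi)) (cs.wordProd_mem_parabolic hω₀)
    · rw [cs.not_isLeftDescent_iff.mp hd, hlen, List.length_cons]
      ring

/-- Every element of a standard parabolic subgroup has a reduced word with letters in it. -/
theorem exists_isReduced_of_mem_parabolic (cs : CoxeterSystem M W) {I : Set B} {a : W}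
    (ha : a ∈ cs.parabolic I) :
    ∃ ω : List B, (∀ i ∈ ω, i ∈ I) ∧ cs.wordProd ω = a ∧ cs.IsReduced ω ∧
      ∀ ω' : List B, (∀ i ∈ ω', i ∈ I) → cs.wordProd ω' = cs.wordProd ω →
        ω.length ≤ ω'.length := by
  have hne : {ω : List B | (∀ i ∈ ω, i ∈ I) ∧ cs.wordProd ω = a}.Nonempty :=
    cs.exists_word_of_mem_parabolic ha
  obtain ⟨ω, ⟨hω, rfl⟩, hmin⟩ := (measure List.length).wf.has_min _ hne
  have hmin' : ∀ ω' : List B, (∀ i ∈ ω', i ∈ I) → cs.wordProd ω' = cs.wordProd ω →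
      ω.length ≤ ω'.length := fun ω' h h' ↦ not_lt.mp (hmin ω' ⟨h, h'⟩)
  refine ⟨ω, hω, rfl, ?_, hmin'⟩
  have := cs.length_wordProd_mul_of_minimal (v := 1) (by simp) hω hmin'
  simpa [IsReduced] using this

/-- If `v` has no left descents in `I`, then it is the shortest element of its coset `W_I v`. -/
theorem length_mul_of_forall_not_isLeftDescent (cs : CoxeterSystem M W) {I : Set B} {a v : W}
    (hv : ∀ i ∈ I, ¬ cs.IsLeftDescent v i) (ha : a ∈ cs.parabolic I) :
    cs.length (a * v) = cs.length a + cs.length v := by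
  have key : ∀ v : W, (∀ a ∈ cs.parabolic I, cs.length v ≤ cs.length (a * v)) →
      ∀ a ∈ cs.parabolic I, cs.length (a * v) = cs.length a + cs.length v := by
    intro v hv a ha
    obtain ⟨ω, hω, rfl, hred, hmin⟩ := cs.exists_isReduced_of_mem_parabolic ha
    rw [cs.length_wordProd_mul_of_minimal hv hω hmin, hred.eq]
  refine key v ?_ a ha
  have hne : {x : W | x * v⁻¹ ∈ cs.parabolic I}.Nonempty := ⟨v, by simp [one_mem]⟩
  obtain ⟨x, hx, hmin⟩ := (measure cs.length).wf.has_min _ hne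
  have hxmin : ∀ a ∈ cs.parabolic I, cs.length x ≤ cs.length (a * x) := fun a ha ↦
    not_lt.mp (hmin (a * x) (by
      change a * x * v⁻¹ ∈ cs.parabolic I
      rw [mul_assoc]
      exact mul_mem ha hx))
  obtain ⟨ω, hω, hprod, hred, -⟩ := cs.exists_isReduced_of_mem_parabolic (inv_mem hx)
  rw [mul_inv_rev, inv_inv] at hprod
  cases ω with
  | nil =>
    rw [wordProd_nil, eq_comm, mul_inv_eq_one] at hprod
    rwa [hprod]
  | cons i ω =>
    exfalso
    apply hv i (hω i (by simp))
    have hω₀ : ∀ j ∈ ω, j ∈ I := fun j hj ↦ hω j (List.mem_cons_of_mem _ hj)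
    have hvx : v = cs.wordProd (i :: ω) * x := by rw [hprod]; group
    have h1 := key x hxmin _ (cs.wordProd_mem_parabolic hω)
    have h2 := key x hxmin _ (cs.wordProd_mem_parabolic hω₀)
    have h3 := cs.length_wordProd_le ω
    rw [← hvx, hred.eq, List.length_cons] at h1
    rw [IsLeftDescent, h1, hvx, wordProd_cons, mul_assoc, simple_mul_simple_cancel_left, h2]
    lia

theorem isLeftDescent_simple_iff (cs : CoxeterSystem M W) (i j : B) :
    cs.IsLeftDescent (cs.simple j) i ↔ cs.simple i = cs.simple j := by
  rw [isLeftDescent_iff_inversionParity, inv_simple, inversionParity_simple]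
  split_ifs with h <;> simp [h]

theorem isLeftDescent_simple_mul_self_iff (cs : CoxeterSystem M W) (w : W) (i : B) :
    cs.IsLeftDescent (cs.simple i * w) i ↔ ¬ cs.IsLeftDescent w i := by
  have := cs.length_simple_mul_ne w i
  rw [IsLeftDescent, IsLeftDescent, simple_mul_simple_cancel_left]
  lia

/-- Two left descents of one element, one of them satisfying the nested condition, commute. -/
theorem coxeterMatrix_eq_two_of_nested (cs : CoxeterSystem M W) {u j : B} (hn : Nested cs u)
    {w : W} (hju : j ≠ u) (hj : cs.IsLeftDescent w j) (hu : cs.IsLeftDescent w u) :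
    M j u = 2 := by
  by_contra hM
  have hcomm : ¬ Commute (cs.simple j) (cs.simple u) := fun h ↦
    hM (cs.coxeterMatrix_eq_two_of_commute hju h)
  have hne : cs.simple u ≠ cs.simple j := fun h ↦ hcomm (by rw [h])
  have hp (g : W) : g ∈ Hp cs u ↔ ¬ cs.IsLeftDescent g u := by
    have := cs.length_simple_mul_ne g u
    rw [Hp, Set.mem_ofPred_eq, IsLeftDescent]
    lia
  have hm (g : W) : g ∈ Hm cs u ↔ cs.IsLeftDescent g u := Iff.rfl
  have h1 : (1 : W) ∈ Hp cs u := (hp _).mpr (cs.not_isLeftDescent_one u)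
  have hs : cs.simple j ∈ Hp cs u := (hp _).mpr (by rwa [isLeftDescent_simple_iff])
  have hsu : cs.simple j * cs.simple u ∈ Hp cs u := by
    rw [hp]
    intro h
    exact hcomm (cs.simple_mul_eq_mul_simple ((hp _).mp hs) h).symm
  have huu : cs.simple u ∈ Hm cs u := (hm _).mpr (by rw [isLeftDescent_simple_iff])
  have hdisj (g : W) (h : g ∈ Hp cs u) (h' : g ∈ Hm cs u) : False := (hp g).mp h h'
  have hmem (g : W) (A : Set W) : g ∈ cs.simple j • A ↔ cs.simple j * g ∈ A := by
    rw [Set.mem_smul_set_iff_inv_smul_mem, smul_eq_mul, inv_simple]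
  have hb : ¬ cs.IsLeftDescent (cs.simple j * w) u := by
    intro hsw
    have e1 : (1 : W) ∈ cs.simple j • Hp cs u := (hmem _ _).mpr (by simpa using hs)
    have eu : cs.simple u ∈ cs.simple j • Hp cs u := (hmem _ _).mpr hsu
    have esu : cs.simple j * cs.simple u ∈ cs.simple j • Hm cs u := (hmem _ _).mpr (by simpa)
    rcases hn (cs.simple j) with h | h | h | h | h | h
    · exact hdisj _ (h ▸ eu) huu
    · exact hdisj _ h1 (h ▸ e1)
    · exact hdisj _ (h.subset eu) huu
    · exact hdisj _ h1 (h.subset e1)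
    · exact hdisj _ (h.subset ((hmem _ _).mpr hsw)) hu
    · exact hdisj _ hsu (h.subset esu)
  have hI : ∀ i ∈ ({j, u} : Set B), ¬ cs.IsLeftDescent (cs.simple j * w) i := by
    rintro i (rfl | rfl)
    · rwa [isLeftDescent_simple_mul_self_iff, not_not]
    · exact hb
  have hN := cs.inversionParity_inv_eq_zero_of_minimal (I := {j, u}) (v := cs.simple j * w)
    (t := cs.simple j * cs.simple u * cs.simple j)
    (fun a ha ↦ by rw [cs.length_mul_of_forall_not_isLeftDescent hI ha]; lia)
    (mul_mem (mul_mem (cs.simple_mem_parabolic (by simp)) (cs.simple_mem_parabolic (by simp)))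
      (cs.simple_mem_parabolic (by simp)))
  rw [isLeftDescent_iff_inversionParity,
    show w⁻¹ = (cs.simple j * w)⁻¹ * cs.simple j by simp, inversionParity_mul,
    inversionParity_simple, if_neg hne, inv_simple, hN] at hu
  simp at hu

theorem commute_of_coxeterMatrix_eq_two (cs : CoxeterSystem M W) {i j : B} (h : M i j = 2) :
    Commute (cs.simple i) (cs.simple j) := by
  have := cs.simple_mul_simple_pow i j
  rw [h, sq, mul_eq_one_iff_eq_inv] at this
  simpa [Commute, SemiconjBy] using this

/-- An element commuting with `s_u` and without left descent `u` lies in the parabolic subgroup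
generated by the simple reflections commuting with `s_u`. -/
theorem mem_WTu_of_commute (cs : CoxeterSystem M W) {u : B} (hn : Nested cs u) {w : W}
    (hc : Commute (cs.simple u) w) (hw : ¬ cs.IsLeftDescent w u) : w ∈ WTu cs u := by
  induction hk : cs.length w using Nat.strong_induction_on generalizing w with
  | _ k ih =>
    by_cases h1 : w = 1
    · rw [h1]
      exact one_mem _
    obtain ⟨j, hj⟩ := cs.exists_leftDescent_of_ne_one h1
    have hju : j ≠ u := by
      rintro rfl
      exact hw hj
    have hjd : cs.IsLeftDescent (cs.simple u * w) j := by
      have h2 := cs.not_isLeftDescent_iff.mp hw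
      have h3 := cs.isLeftDescent_iff.mp hj
      have h4 := cs.length_mul_le (cs.simple j * w) (cs.simple u)
      rw [cs.length_simple, mul_assoc, ← hc.eq] at h4
      rw [IsLeftDescent]
      lia
    have hM := cs.coxeterMatrix_eq_two_of_nested hn hju hjd
      ((cs.isLeftDescent_simple_mul_self_iff _ _).mpr hw)
    have hcj := (cs.commute_of_coxeterMatrix_eq_two hM).symm
    have hmem : cs.simple j ∈ WTu cs u := cs.simple_mem_parabolic (I := {j | M j u = 2}) hM
    have hlt := hj
    rw [IsLeftDescent, hk] at hlt
    have hne : cs.simple u ≠ cs.simple j := fun h ↦ hw (by rwa [IsLeftDescent, h])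
    have := ih _ hlt (hcj.mul_right hc)
      (by rwa [cs.isLeftDescent_simple_mul_iff hne hcj]) rfl
    simpa using mul_mem hmem this

theorem exists_mul_eq_of_parabolic (cs : CoxeterSystem M W) (I : Set B) (w : W) :
    ∃ a ∈ cs.parabolic I, ∃ v, (∀ i ∈ I, ¬ cs.IsLeftDescent v i) ∧ w = a * v := by
  induction hk : cs.length w using Nat.strong_induction_on generalizing w with
  | _ k ih =>
    by_cases h : ∀ i ∈ I, ¬ cs.IsLeftDescent w i
    · exact ⟨1, one_mem _, w, h, (one_mul w).symm⟩
    · push Not at h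
      obtain ⟨i, hi, hd⟩ := h
      rw [IsLeftDescent, hk] at hd
      obtain ⟨a, ha, v, hv, he⟩ := ih _ hd _ rfl
      exact ⟨cs.simple i * a, mul_mem (cs.simple_mem_parabolic hi) ha, v, hv, by
        rw [mul_assoc, ← he, simple_mul_simple_cancel_left]⟩

theorem commute_of_mem_WTu (cs : CoxeterSystem M W) {u : B} {a : W} (ha : a ∈ WTu cs u) :
    Commute (cs.simple u) a := by
  obtain ⟨ω, hω, rfl⟩ := cs.exists_word_of_mem_parabolic (I := {j | M j u = 2}) ha
  induction ω with
  | nil => simp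
  | cons i ω ih =>
    have hω₀ : ∀ j ∈ ω, j ∈ {j | M j u = 2} := fun j hj ↦ hω j (List.mem_cons_of_mem _ hj)
    rw [wordProd_cons]
    exact (cs.commute_of_coxeterMatrix_eq_two (hω i (by simp))).symm.mul_right
      (ih hω₀ (cs.wordProd_mem_parabolic hω₀))

theorem WTu_le_parabolic_compl (cs : CoxeterSystem M W) (u : B) :
    WTu cs u ≤ cs.parabolic {j | j ≠ u} :=
  cs.parabolic_mono (I := {j | M j u = 2}) fun j hj ↦ by
    rintro rfl
    simp at hj

end CoxeterSystem

namespace IsBuilding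

variable {Δ : Type*} {d : Δ → Δ → W}

theorem dist_eq_one_iff {cs : CoxeterSystem M W} (hb : IsBuilding cs Δ d) {C D : Δ} :
    d C D = 1 ↔ C = D := hb.2.1 C D

theorem dist_eq_or {cs : CoxeterSystem M W} (hb : IsBuilding cs Δ d) {C E : Δ} {i : B}
    (h : d E C = cs.simple i) (D : Δ) : d E D = cs.simple i * d C D ∨ d E D = d C D :=
  (hb.2.2.1 C D E i h).1

theorem dist_eq_of_not_isLeftDescent {cs : CoxeterSystem M W} (hb : IsBuilding cs Δ d)
    {C D E : Δ} {i : B} (h : d E C = cs.simple i) (hd : ¬ cs.IsLeftDescent (d C D) i) :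
    d E D = cs.simple i * d C D :=
  (hb.2.2.1 C D E i h).2 (by rw [cs.not_isLeftDescent_iff.mp hd]; exact Nat.lt_succ_self _)

theorem exists_adjacent {cs : CoxeterSystem M W} (hb : IsBuilding cs Δ d) (C D : Δ) (i : B) :
    ∃ E, d E C = cs.simple i ∧ d E D = cs.simple i * d C D := hb.2.2.2 C D i

theorem dist_comm_simple {cs : CoxeterSystem M W} (hb : IsBuilding cs Δ d) {C E : Δ} {i : B}
    (h : d E C = cs.simple i) : d C E = cs.simple i := by
  rcases hb.dist_eq_or h E with h' | h'
  · rw [hb.dist_eq_one_iff.mpr rfl, eq_comm, mul_eq_one_iff_eq_inv] at h'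
    rw [← inv_eq_iff_eq_inv.mpr h', cs.inv_simple]
  · rw [hb.dist_eq_one_iff.mpr rfl, eq_comm, hb.dist_eq_one_iff] at h'
    rw [h', hb.dist_eq_one_iff.mpr rfl] at h
    rw [h', hb.dist_eq_one_iff.mpr rfl, h]

theorem exists_adjacent_cons {cs : CoxeterSystem M W} (hb : IsBuilding cs Δ d) {C D : Δ} {i : B}
    {w : W} (h : d C D = cs.simple i * w) : ∃ E, d C E = cs.simple i ∧ d E D = w := by
  obtain ⟨E, hE, hD⟩ := hb.exists_adjacent C D i
  exact ⟨E, hb.dist_comm_simple hE, by rw [hD, h, cs.simple_mul_simple_cancel_left]⟩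

theorem dist_wordProd {cs : CoxeterSystem M W} (hb : IsBuilding cs Δ d) {C D E : Δ} {ω : List B}
    (h : d C D = cs.wordProd ω)
    (hl : cs.length (cs.wordProd ω * d D E) = ω.length + cs.length (d D E)) :
    d C E = cs.wordProd ω * d D E := by
  induction ω generalizing C with
  | nil =>
    rw [cs.wordProd_nil, hb.dist_eq_one_iff] at h
    rw [h, cs.wordProd_nil, one_mul]
  | cons i ω ih =>
    rw [cs.wordProd_cons] at h
    obtain ⟨C', hC, hD⟩ := hb.exists_adjacent_cons h
    rw [cs.wordProd_cons, mul_assoc, List.length_cons] at hl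
    have h1 := cs.length_mul_le (cs.wordProd ω) (d D E)
    have h2 := cs.length_wordProd_le ω
    have h3 := cs.length_mul_le (cs.simple i) (cs.wordProd ω * d D E)
    rw [cs.length_simple] at h3
    have hE := ih hD (by lia)
    rw [cs.wordProd_cons, mul_assoc, ← hE]
    refine hb.dist_eq_of_not_isLeftDescent hC ?_
    rw [CoxeterSystem.IsLeftDescent, hE]
    lia

theorem dist_eq_mul {cs : CoxeterSystem M W} (hb : IsBuilding cs Δ d) {C D E : Δ}
    (hl : cs.length (d C D * d D E) = cs.length (d C D) + cs.length (d D E)) :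
    d C E = d C D * d D E := by
  obtain ⟨ω, hω, h⟩ := cs.exists_isReduced (d C D)
  rw [h]
  refine hb.dist_wordProd h ?_
  rwa [← hω.eq, ← h]

theorem dist_comm {cs : CoxeterSystem M W} (hb : IsBuilding cs Δ d) (C D : Δ) :
    d D C = (d C D)⁻¹ := by
  obtain ⟨ω, hω, h⟩ := cs.exists_isReduced (d C D)
  induction ω generalizing C with
  | nil =>
    rw [cs.wordProd_nil, hb.dist_eq_one_iff] at h
    rw [h, hb.dist_eq_one_iff.mpr rfl, inv_one]
  | cons i ω ih =>
    rw [cs.wordProd_cons] at h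
    obtain ⟨C', hC, hD⟩ := hb.exists_adjacent_cons h
    have hω' : cs.IsReduced ω := hω.drop 1
    have hD' := ih C' hω' hD
    rw [hD] at hD'
    have hC' := hb.dist_comm_simple hC
    have hl := hω.eq
    rw [cs.wordProd_cons, List.length_cons] at hl
    rw [hb.dist_eq_mul (D := C'), hD', hC', h, mul_inv_rev, cs.inv_simple]
    rw [hD', hC', cs.length_simple, cs.length_inv, hω'.eq, ← cs.length_inv, mul_inv_rev, inv_inv,
      cs.inv_simple, hl]

theorem exists_between {cs : CoxeterSystem M W} (hb : IsBuilding cs Δ d) {C D : Δ} {v w : W}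
    (h : d C D = v * w) : ∃ E, d C E = v ∧ d E D = w := by
  obtain ⟨ω, hω, rfl⟩ := cs.exists_isReduced v
  induction ω generalizing C with
  | nil => exact ⟨C, by rw [hb.dist_eq_one_iff.mpr rfl, cs.wordProd_nil], by simpa using h⟩
  | cons i ω ih =>
    rw [cs.wordProd_cons, mul_assoc] at h
    obtain ⟨C', hC, hD⟩ := hb.exists_adjacent_cons h
    have hω' : cs.IsReduced ω := hω.drop 1
    obtain ⟨E, hE, hED⟩ := ih hω' hD
    refine ⟨E, ?_, hED⟩
    have hl := hω.eq
    rw [cs.wordProd_cons, List.length_cons] at hl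
    rw [cs.wordProd_cons, ← hE]
    refine hb.dist_eq_of_not_isLeftDescent hC ?_
    rw [CoxeterSystem.IsLeftDescent, hE, hl, hω'.eq]
    lia

theorem dist_mem_parabolic_trans {cs : CoxeterSystem M W} (hb : IsBuilding cs Δ d) {I : Set B}
    {C D E : Δ} (h : d C D ∈ cs.parabolic I) (h' : d D E ∈ cs.parabolic I) :
    d C E ∈ cs.parabolic I := by
  obtain ⟨ω, hω, hp⟩ := cs.exists_word_of_mem_parabolic h
  clear h
  induction ω generalizing C with
  | nil =>
    rw [cs.wordProd_nil, eq_comm, hb.dist_eq_one_iff] at hp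
    rwa [hp]
  | cons i ω ih =>
    rw [cs.wordProd_cons] at hp
    obtain ⟨C', hC, hD⟩ := hb.exists_adjacent_cons hp.symm
    have hm := ih (fun j hj ↦ hω j (List.mem_cons_of_mem _ hj)) hD.symm
    rcases hb.dist_eq_or hC E with he | he <;> rw [he]
    · exact mul_mem (cs.simple_mem_parabolic (hω i (by simp))) hm
    · exact hm

theorem dist_mem_parabolic_comm {cs : CoxeterSystem M W} (hb : IsBuilding cs Δ d) {I : Set B}
    {C D : Δ} (h : d C D ∈ cs.parabolic I) : d D C ∈ cs.parabolic I := by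
  rw [hb.dist_comm C D]
  exact inv_mem h

theorem isLeftDescent_iff_of_dist_mem_WTu {cs : CoxeterSystem M W} (hb : IsBuilding cs Δ d)
    {u : B} {C D : Δ} (h : d C D ∈ WTu cs u) (Y : Δ) :
    cs.IsLeftDescent (d C Y) u ↔ cs.IsLeftDescent (d D Y) u := by
  obtain ⟨ω, hω, hp⟩ := cs.exists_word_of_mem_parabolic (I := {j | M j u = 2}) h
  clear h
  induction ω generalizing C with
  | nil =>
    rw [cs.wordProd_nil, eq_comm, hb.dist_eq_one_iff] at hp
    rw [hp]
  | cons i ω ih =>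
    rw [cs.wordProd_cons] at hp
    obtain ⟨C', hC, hD⟩ := hb.exists_adjacent_cons hp.symm
    have hi : M i u = 2 := hω i (by simp)
    rw [← ih (fun j hj ↦ hω j (List.mem_cons_of_mem _ hj)) hD.symm]
    rcases hb.dist_eq_or hC Y with he | he <;> rw [he]
    have hiu : u ≠ i := by
      rintro rfl
      simp at hi
    exact cs.isLeftDescent_simple_mul_iff (cs.simple_ne_simple_of_ne hiu)
      (cs.commute_of_coxeterMatrix_eq_two hi).symm _

/-- The projection of a chamber to a residue is unique. -/
theorem eq_of_forall_not_isLeftDescent {cs : CoxeterSystem M W} (hb : IsBuilding cs Δ d)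
    {I : Set B} {p q Y : Δ} (hp : ∀ i ∈ I, ¬ cs.IsLeftDescent (d p Y) i)
    (hq : ∀ i ∈ I, ¬ cs.IsLeftDescent (d q Y) i) (hqp : d q p ∈ cs.parabolic I) : q = p := by
  have h1 := cs.length_mul_of_forall_not_isLeftDescent hp hqp
  have h2 := cs.length_mul_of_forall_not_isLeftDescent hq (hb.dist_mem_parabolic_comm hqp)
  rw [← hb.dist_eq_mul h1] at h1
  rw [← hb.dist_eq_mul h2] at h2
  rw [← hb.dist_eq_one_iff, ← cs.length_eq_zero_iff]
  lia

theorem exists_dist_mem_WTu_forall_not_isLeftDescent {cs : CoxeterSystem M W}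
    (hb : IsBuilding cs Δ d) {u : B} (hn : Nested cs u) {p Y : Δ}
    (hp : cs.IsLeftDescent (d p Y) u) :
    ∃ q, d p q ∈ WTu cs u ∧ ∀ j ∈ {j | j ≠ u}, ¬ cs.IsLeftDescent (d q Y) j := by
  induction hk : cs.length (d p Y) using Nat.strong_induction_on generalizing p with
  | _ k ih =>
    by_cases h : ∀ j ∈ {j | j ≠ u}, ¬ cs.IsLeftDescent (d p Y) j
    · refine ⟨p, ?_, h⟩
      rw [hb.dist_eq_one_iff.mpr rfl]
      exact one_mem _
    · push Not at h
      obtain ⟨j, hj, hd⟩ := h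
      have hM := cs.coxeterMatrix_eq_two_of_nested hn hj hd hp
      obtain ⟨E, hE, hEY⟩ := hb.exists_adjacent p Y j
      have hEp : d E p ∈ WTu cs u := by
        rw [hE]
        exact cs.simple_mem_parabolic (I := {j | M j u = 2}) hM
      obtain ⟨q, hq, hqY⟩ := ih _ (by rwa [CoxeterSystem.IsLeftDescent, hk, ← hEY] at hd)
        ((hb.isLeftDescent_iff_of_dist_mem_WTu hEp Y).mpr hp) rfl
      exact ⟨q, hb.dist_mem_parabolic_trans (I := {j | M j u = 2})
        (hb.dist_mem_parabolic_comm hEp) hq, hqY⟩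

theorem dist_mem_WTu_of_mem_parabolic {cs : CoxeterSystem M W} (hb : IsBuilding cs Δ d) {u : B}
    (hn : Nested cs u) {p q Y : Δ} (hp : cs.IsLeftDescent (d p Y) u)
    (hq : cs.IsLeftDescent (d q Y) u) (hqp : d q p ∈ cs.parabolic {j | j ≠ u}) :
    d q p ∈ WTu cs u := by
  obtain ⟨p', hp', hpY⟩ := hb.exists_dist_mem_WTu_forall_not_isLeftDescent hn hp
  obtain ⟨q', hq', hqY⟩ := hb.exists_dist_mem_WTu_forall_not_isLeftDescent hn hq
  have hle := cs.WTu_le_parabolic_compl u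
  have h := hb.eq_of_forall_not_isLeftDescent hpY hqY (hb.dist_mem_parabolic_trans
    (hb.dist_mem_parabolic_comm (hle hq')) (hb.dist_mem_parabolic_trans hqp (hle hp')))
  rw [h] at hq'
  exact hb.dist_mem_parabolic_trans (I := {j | M j u = 2}) hq' (hb.dist_mem_parabolic_comm hp')

theorem dist_mem_WTu_or_isLeftDescent {cs : CoxeterSystem M W} (hb : IsBuilding cs Δ d) {u : B}
    (hn : Nested cs u) {p q Y : Δ} (hp : cs.IsLeftDescent (d p Y) u)
    (hq : cs.IsLeftDescent (d q Y) u) (hqp : ¬ cs.IsRightDescent (d q p) u) :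
    d q p ∈ WTu cs u ∨ cs.IsLeftDescent (d q p) u := by
  induction hk : cs.length (d q p) using Nat.strong_induction_on generalizing p with
  | _ k ih =>
    obtain ⟨a, ha, v, hv, he⟩ := cs.exists_mul_eq_of_parabolic {j | j ≠ u} (d q p)⁻¹
    have hlen := cs.length_mul_of_forall_not_isLeftDescent hv ha
    rw [← he, cs.length_inv] at hlen
    by_cases hv1 : v = 1
    · left
      refine hb.dist_mem_WTu_of_mem_parabolic hn hp hq ?_
      rwa [← inv_mem_iff, he, hv1, mul_one]
    obtain ⟨j, hj⟩ := cs.exists_leftDescent_of_ne_one hv1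
    obtain rfl : j = u := by
      by_contra hju
      exact hv j hju hj
    obtain ⟨w, rfl⟩ : ∃ w, v = cs.simple j * w⁻¹ := ⟨(cs.simple j * v)⁻¹, by simp⟩
    have hjw := cs.isLeftDescent_iff.mp hj
    rw [cs.simple_mul_simple_cancel_left, cs.length_inv] at hjw
    rw [← hjw] at hlen
    obtain ⟨b, rfl⟩ : ∃ b, a = b⁻¹ := ⟨a⁻¹, (inv_inv a).symm⟩
    rw [inv_mem_iff] at ha
    rw [cs.length_inv] at hlen
    have he' : d q p = w * (cs.simple j * b) := by
      rw [← inv_inj, he]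
      simp [mul_assoc]
    obtain ⟨E, hqE, hEp⟩ := hb.exists_between he'
    obtain ⟨D, hED, hDp⟩ := hb.exists_adjacent_cons hEp
    have hbT : b ∉ WTu cs j := fun hbT ↦ hqp <| by
      have := cs.length_mul_le w b
      rw [CoxeterSystem.IsRightDescent, hlen, he', (cs.commute_of_mem_WTu hbT).eq, mul_assoc,
        cs.simple_mul_simple_cancel_right]
      lia
    have hDY : ¬ cs.IsLeftDescent (d D Y) j := fun hDY ↦ hbT <| by
      rw [← hDp] at ha ⊢
      exact hb.dist_mem_WTu_of_mem_parabolic hn hp hDY ha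
    have hEY : cs.IsLeftDescent (d E Y) j := by
      rwa [hb.dist_eq_of_not_isLeftDescent hED hDY, cs.isLeftDescent_simple_mul_self_iff]
    right
    rcases ih _ (by rw [hqE]; lia) hEY (by
      rw [hqE, ← cs.isLeftDescent_inv_iff, CoxeterSystem.IsLeftDescent, ← hjw, cs.length_inv]
      lia) rfl with h | h <;> rw [hqE] at h
    · have := cs.length_mul_le w b
      rw [CoxeterSystem.IsLeftDescent, hlen, he', ← mul_assoc w, ← (cs.commute_of_mem_WTu h).eq,
        mul_assoc, cs.simple_mul_simple_cancel_left]
      lia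
    · have h1 := cs.length_mul_le (cs.simple j * w) (cs.simple j * b)
      have h2 := cs.length_mul_le (cs.simple j) b
      rw [cs.length_simple] at h2
      rw [CoxeterSystem.IsLeftDescent] at h ⊢
      rw [hlen, he', ← mul_assoc]
      lia

/-- The metric form of the Cotlar identity. -/
theorem isLeftDescent_iff_or_isLeftDescent_iff {Δ : Type*} {d : Δ → Δ → W}
    {cs : CoxeterSystem M W} (hb : IsBuilding cs Δ d) {u : B} (hn : Nested cs u) {A X : Δ}
    (hAX : d A X ∉ WTu cs u) (Y : Δ) :
    (cs.IsLeftDescent (d A X) u ↔ cs.IsLeftDescent (d A Y) u) ∨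
      (cs.IsLeftDescent (d X Y) u ↔ cs.IsLeftDescent (d X A) u) := by
  have mixed : ∀ {A X : Δ}, d A X ∉ WTu cs u → cs.IsLeftDescent (d A X) u →
      ¬ cs.IsLeftDescent (d X A) u → ¬ cs.IsLeftDescent (d A Y) u →
      ¬ cs.IsLeftDescent (d X Y) u := by
    intro A X hAX hx hx' hy hz
    obtain ⟨p, hp, hpX⟩ := hb.exists_adjacent A X u
    have hpY := hb.dist_eq_of_not_isLeftDescent hp hy
    have hXp : d X p = d X A * cs.simple u := by
      rw [hb.dist_comm p X, hpX, hb.dist_comm X A, mul_inv_rev, inv_inv, cs.inv_simple]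
    have hXA : d X A = d X p * cs.simple u := by
      rw [hXp, cs.simple_mul_simple_cancel_right]
    have hr : ¬ cs.IsRightDescent (d X p) u := by
      rw [← cs.isLeftDescent_inv_iff, ← hb.dist_comm X p, hpX,
        cs.isLeftDescent_simple_mul_self_iff, not_not]
      exact hx
    rcases hb.dist_mem_WTu_or_isLeftDescent hn (p := p) (q := X) (Y := Y)
      (by rwa [hpY, cs.isLeftDescent_simple_mul_self_iff]) hz hr with h | h
    · apply hx'
      have hd : ¬ cs.IsLeftDescent (d X p) u := by
        rwa [CoxeterSystem.IsLeftDescent, (cs.commute_of_mem_WTu h).eq]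
      rwa [hXA, ← (cs.commute_of_mem_WTu h).eq, cs.isLeftDescent_simple_mul_self_iff]
    · apply hx'
      have h1 := cs.isLeftDescent_iff.mp h
      have h2 := cs.not_isRightDescent_iff.mp hr
      have h3 := cs.length_mul_le (cs.simple u * d X p) (cs.simple u)
      rw [cs.length_simple, mul_assoc, ← hXA] at h3
      rw [← hXA] at h2
      rw [CoxeterSystem.IsLeftDescent]
      lia
  have hXA : d X A = (d A X)⁻¹ := hb.dist_comm A X
  have hXAm : d X A ∉ WTu cs u := by rwa [hXA, inv_mem_iff]
  by_contra hcon
  rw [not_or] at hcon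
  obtain ⟨hy, hz⟩ := hcon
  by_cases hx : cs.IsLeftDescent (d A X) u <;> by_cases hx' : cs.IsLeftDescent (d X A) u <;>
    simp only [hx, hx', true_iff, iff_true, false_iff, iff_false, not_not] at hy hz
  · by_cases hc : Commute (cs.simple u) (d A X)
    · have hm : cs.simple u * d A X ∈ WTu cs u := cs.mem_WTu_of_commute hn
        ((Commute.refl _).mul_right hc) (by rwa [cs.isLeftDescent_simple_mul_self_iff, not_not])
      obtain ⟨p, hp, hpX⟩ := hb.exists_adjacent A X u
      rw [← hpX] at hm
      apply hz
      rwa [← hb.isLeftDescent_iff_of_dist_mem_WTu hm,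
        hb.dist_eq_of_not_isLeftDescent hp hy, cs.isLeftDescent_simple_mul_self_iff]
    · obtain ⟨p, hp, hpX⟩ := hb.exists_adjacent A X u
      obtain ⟨q, hq, hqp⟩ := hb.exists_adjacent X p u
      have hqp' : d q p = cs.simple u * (d A X)⁻¹ * cs.simple u := by
        rw [hqp, hb.dist_comm p X, hpX, mul_inv_rev, cs.inv_simple, mul_assoc]
      have key : ∀ x, ¬ Commute (cs.simple u) x → cs.IsLeftDescent x u →
          ¬ cs.IsLeftDescent (cs.simple u * x * cs.simple u) u := by
        intro x hxc hxu h
        have := cs.simple_mul_eq_mul_simple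
          (by rwa [cs.isLeftDescent_simple_mul_self_iff, not_not]) h
        rw [cs.simple_mul_simple_cancel_left] at this
        apply hxc
        rw [Commute, SemiconjBy]
        nth_rw 1 [this]
        rw [mul_assoc, cs.simple_mul_simple_cancel_left]
      rw [hXA] at hx'
      rcases hb.dist_mem_WTu_or_isLeftDescent hn (p := p) (q := q) (Y := Y)
        (by rwa [hb.dist_eq_of_not_isLeftDescent hp hy, cs.isLeftDescent_simple_mul_self_iff])
        (by rwa [hb.dist_eq_of_not_isLeftDescent hq hz, cs.isLeftDescent_simple_mul_self_iff])
        (by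
          rw [← cs.isLeftDescent_inv_iff, hqp', mul_inv_rev, mul_inv_rev, inv_inv, cs.inv_simple,
            ← mul_assoc]
          exact key _ hc hx) with h | h
      · have he := (cs.commute_of_mem_WTu h).eq
        have hqX : d q p = d X A := by
          rw [← cs.simple_mul_simple_cancel_left (w := d q p) u, he, hqp', hXA]
          simp [mul_assoc]
        exact hXAm (hqX ▸ h)
      · rw [hqp'] at h
        exact key _ (fun h ↦ hc (by simpa using h)) hx' h
  · exact mixed hAX hx hx' hy hz
  · exact mixed hXAm hx' hx hz hy
  · rcases hb.dist_mem_WTu_or_isLeftDescent hn (p := A) (q := X) (Y := Y) hy hz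
      (by rwa [← cs.isLeftDescent_inv_iff, ← hb.dist_comm]) with h | h
    · exact hXAm h
    · exact hx' h

end IsBuilding

/-- The multiplier `m_G^u` of a group acting on a building with the nested condition satisfies
the Cotlar identity relative to `G₀`. -/
theorem cotlar_identity_for_building_action {G : Type*} [Group G] (cs : CoxeterSystem M W)
    (u : B) (hnest : Nested cs u) {Δ : Type*} (d : Δ → Δ → W) (hb : IsBuilding cs Δ d)
    [MulAction G Δ] (hact : ∀ (g : G) (C D : Δ), d (g • C) (g • D) = d C D)
    (C₀ : Δ) :
    ∀ g : G, g ∉ {g : G | d C₀ (g • C₀) ∈ WTu cs u} → ∀ h : G,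
      (mG cs d C₀ u g - mG cs d C₀ u h) *
        (mG cs d C₀ u (g⁻¹ * h) - mG cs d C₀ u g⁻¹) = 0 := by
  intro g hg h
  have hz : d C₀ ((g⁻¹ * h) • C₀) = d (g • C₀) (h • C₀) := by
    rw [← hact g, smul_smul, mul_inv_cancel_left]
  have hx' : d C₀ (g⁻¹ • C₀) = d (g • C₀) C₀ := by
    rw [← hact g, smul_inv_smul]
  have hm (w : W) : cs.length w < cs.length (cs.simple u * w) ↔ ¬ cs.IsLeftDescent w u := by
    have := cs.length_simple_mul_ne w u
    rw [CoxeterSystem.IsLeftDescent]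
    lia
  simp only [mG, hz, hx', hm]
  rcases hb.isLeftDescent_iff_or_isLeftDescent_iff hnest hg (h • C₀) with h' | h' <;> simp [h']
end
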